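/- Let L > 0, T > 0, and y ∈ L^2(0,T; H^3(0,L)) solve y_t + y_x + y_{xxx} + y y_x = 0 in the distributional sense. If y(t,x) = 0 for all t ∈ (t_1,t_2) and all x in a nonempty open subset ω ⊂ (0,L), then y(t,x) = 0 for all t ∈ (t_1,t_2) and all x ∈ (0,L). -/

import Mathlib

open scoped BigOperators
open MeasureTheory intervalIntegral Real Set
open Filter Topology

structure Tame (b c τ₁ τ₂ N : ℝ) (w0 w1 w2 wt : ℝ → ℝ → ℝ) : Prop where
  d0 : ∀ t ∈ Ioo τ₁ τ₂, ∀ x ∈ Icc b c, HasDerivAt (w0 t) (w1 t x) x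
  d1 : ∀ t ∈ Ioo τ₁ τ₂, ∀ x ∈ Icc b c, HasDerivAt (w1 t) (w2 t x) x
  c2 : ∀ t ∈ Ioo τ₁ τ₂, ContinuousOn (w2 t) (Icc b c)
  dt : ∀ t ∈ Ioo τ₁ τ₂, ∀ x ∈ Icc b c, HasDerivAt (fun t => w0 t x) (wt t x) t
  ct1 : ∀ x ∈ Icc b c, ContinuousOn (fun t => w1 t x) (Ioo τ₁ τ₂)
  ct2 : ∀ x ∈ Icc b c, ContinuousOn (fun t => w2 t x) (Ioo τ₁ τ₂)
  b0 : ∀ t ∈ Ioo τ₁ τ₂, ∀ x ∈ Icc b c, |w0 t x| ≤ N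
  b1 : ∀ t ∈ Ioo τ₁ τ₂, ∀ x ∈ Icc b c, |w1 t x| ≤ N
  b2 : ∀ t ∈ Ioo τ₁ τ₂, ∀ x ∈ Icc b c, |w2 t x| ≤ N
  bt : ∀ t ∈ Ioo τ₁ τ₂, ∀ x ∈ Icc b c, |wt t x| ≤ N
  z0 : ∀ t ∈ Ioo τ₁ τ₂, w0 t b = 0
  z1 : ∀ t ∈ Ioo τ₁ τ₂, w1 t b = 0
  z2 : ∀ t ∈ Ioo τ₁ τ₂, w2 t b = 0

/-- the symmetric part -/
noncomputable def SS (s K : ℝ) (w0 w1 w2 : ℝ → ℝ → ℝ) (t x : ℝ) : ℝ :=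
  3 * (s * (K - x)) * w2 t x - 3 * s * w1 t x + (s * (K - x)) ^ 3 * w0 t x

noncomputable def EE (s K b c : ℝ) (w0 w1 : ℝ → ℝ → ℝ) (t : ℝ) : ℝ :=
  ∫ x in b..c, (1 / 2 * ((s * (K - x)) ^ 3 * w0 t x ^ 2 - 3 * (s * (K - x)) * w1 t x ^ 2))

theorem SS_cont {b c τ₁ τ₂ N : ℝ} {w0 w1 w2 wt : ℝ → ℝ → ℝ}
    (h : Tame b c τ₁ τ₂ N w0 w1 w2 wt) (s K : ℝ) {t : ℝ} (ht : t ∈ Ioo τ₁ τ₂) :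
    ContinuousOn (SS s K w0 w1 w2 t) (Icc b c) := by
  have c0 : ContinuousOn (w0 t) (Icc b c) := fun x hx => (h.d0 t ht x hx).continuousAt.continuousWithinAt
  have c1 : ContinuousOn (w1 t) (Icc b c) := fun x hx => (h.d1 t ht x hx).continuousAt.continuousWithinAt
  have c2 := h.c2 t ht
  unfold SS
  fun_prop

theorem EE_diff {b c τ₁ τ₂ N : ℝ} {w0 w1 w2 wt : ℝ → ℝ → ℝ} (hbc : b ≤ c)
    (h : Tame b c τ₁ τ₂ N w0 w1 w2 wt) (s K : ℝ) {t t' : ℝ} (ht : t ∈ Ioo τ₁ τ₂)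
    (ht' : t' ∈ Ioo τ₁ τ₂) :
    EE s K b c w0 w1 t' - EE s K b c w0 w1 t =
      (∫ x in b..c, 1 / 2 * ((w0 t' x - w0 t x) * (SS s K w0 w1 w2 t' x + SS s K w0 w1 w2 t x)))
      - 3 / 2 * (s * (K - c)) * (w0 t' c - w0 t c) * (w1 t' c + w1 t c) := by
  have c0 : ∀ t ∈ Ioo τ₁ τ₂, ContinuousOn (w0 t) (Icc b c) := 
    fun t ht x hx => (h.d0 t ht x hx).continuousAt.continuousWithinAt
  have c1 : ∀ t ∈ Ioo τ₁ τ₂, ContinuousOn (w1 t) (Icc b c) := 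
    fun t ht x hx => (h.d1 t ht x hx).continuousAt.continuousWithinAt
  have a0 := c0 t ht
  have a0' := c0 t' ht'
  have a1 := c1 t ht
  have a1' := c1 t' ht'
  have aS := SS_cont h s K ht
  have aS' := SS_cont h s K ht'
  have a2 := h.c2 t ht
  have a2' := h.c2 t' ht'
  have key : ∫ x in b..c, (1 / 2 * ((w0 t' x - w0 t x) * (SS s K w0 w1 w2 t' x + SS s K w0 w1 w2 t x))
      - (1 / 2 * ((s * (K - x)) ^ 3 * w0 t' x ^ 2 - 3 * (s * (K - x)) * w1 t' x ^ 2)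
        - 1 / 2 * ((s * (K - x)) ^ 3 * w0 t x ^ 2 - 3 * (s * (K - x)) * w1 t x ^ 2)))
      = 3 / 2 * (s * (K - c)) * (w0 t' c - w0 t c) * (w1 t' c + w1 t c)
       - 3 / 2 * (s * (K - b)) * (w0 t' b - w0 t b) * (w1 t' b + w1 t b) := by
    refine intervalIntegral.integral_eq_sub_of_hasDerivAt (f := fun x => 
       3 / 2 * (s * (K - x)) * (w0 t' x - w0 t x) * (w1 t' x + w1 t x)) ?_ ?_
    · intro x hx
      rw [uIcc_of_le hbc] at hx
      have hA : HasDerivAt (fun x : ℝ => 3 / 2 * (s * (K - x))) (3 / 2 * (s * (-1))) x :=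
        (((hasDerivAt_id x).const_sub K).const_mul s).const_mul (3/2)
      refine ((hA.mul ((h.d0 t' ht' x hx).sub (h.d0 t ht x hx))).mul 
        ((h.d1 t' ht' x hx).add (h.d1 t ht x hx))).congr_deriv ?_
      simp only [SS, Pi.mul_apply, Pi.sub_apply, Pi.add_apply]
      ring
    · apply ContinuousOn.intervalIntegrable
      rw [uIcc_of_le hbc]
      fun_prop
  rw [intervalIntegral.integral_sub, intervalIntegral.integral_sub] at key
  · rw [h.z0 t ht, h.z0 t' ht'] at key
    unfold EE
    linarith
  all_goals
    apply ContinuousOn.intervalIntegrable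
    rw [uIcc_of_le hbc]
    fun_prop

theorem EE_deriv {b c τ₁ τ₂ N : ℝ} {w0 w1 w2 wt : ℝ → ℝ → ℝ} (hbc : b ≤ c)
    (h : Tame b c τ₁ τ₂ N w0 w1 w2 wt) (s K : ℝ) {t : ℝ} (ht : t ∈ Ioo τ₁ τ₂) :
    HasDerivAt (EE s K b c w0 w1)
      ((∫ x in b..c, wt t x * SS s K w0 w1 w2 t x) - 3 * (s * (K - c)) * wt t c * w1 t c) t := by
  have hcm : c ∈ Icc b c := ⟨hbc, le_rfl⟩
  have hnh : ∀ᶠ t' in 𝓝[≠] t, t' ∈ Ioo τ₁ τ₂ :=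
    mem_nhdsWithin_of_mem_nhds (Ioo_mem_nhds ht.1 ht.2)
  have hSt : ∀ x ∈ Icc b c, ContinuousAt (fun t => SS s K w0 w1 w2 t x) t := by
    intro x hx
    have c0 := (h.dt t ht x hx).continuousAt
    have c1 := (h.ct1 x hx).continuousAt (Ioo_mem_nhds ht.1 ht.2)
    have c2 := (h.ct2 x hx).continuousAt (Ioo_mem_nhds ht.1 ht.2)
    unfold SS
    fun_prop
  have hSb : ∃ Q, 0 ≤ Q ∧ ∀ t ∈ Ioo τ₁ τ₂, ∀ x ∈ Icc b c, |SS s K w0 w1 w2 t x| ≤ Q := by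
    obtain ⟨Q1, hQ1⟩ := isCompact_Icc.exists_bound_of_continuousOn (s := Icc b c) (f := fun x => 3 * (s * (K - x))) (by fun_prop)
    obtain ⟨Q2, hQ2⟩ := isCompact_Icc.exists_bound_of_continuousOn (s := Icc b c) (f := fun x => (s * (K - x)) ^ 3) (by fun_prop)
    have hN : 0 ≤ N := (abs_nonneg _).trans (h.b0 t ht c hcm)
    have q1 : 0 ≤ Q1 := (norm_nonneg _).trans (hQ1 c hcm)
    have q2 : 0 ≤ Q2 := (norm_nonneg _).trans (hQ2 c hcm)
    refine ⟨Q1 * N + |3 * s| * N + Q2 * N, by positivity, fun t ht x hx => ?_⟩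
    unfold SS
    refine (abs_add_le _ _).trans (add_le_add ((abs_sub _ _).trans (add_le_add ?_ ?_)) ?_)
    · rw [abs_mul]; exact mul_le_mul (hQ1 x hx) (h.b2 t ht x hx) (abs_nonneg _) q1
    · rw [abs_mul]; exact mul_le_mul le_rfl (h.b1 t ht x hx) (abs_nonneg _) (abs_nonneg _)
    · rw [abs_mul]; exact mul_le_mul (hQ2 x hx) (h.b0 t ht x hx) (abs_nonneg _) q2
  obtain ⟨Q, hQ0, hQ⟩ := hSb
  have hslope : ∀ x ∈ Icc b c, Tendsto (fun t' => (w0 t' x - w0 t x) / (t' - t)) (𝓝[≠] t) (𝓝 (wt t x)) := by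
    intro x hx
    have := hasDerivAt_iff_tendsto_slope.1 (h.dt t ht x hx)
    refine this.congr fun t' => ?_
    rw [slope_def_field]
  have hlip : ∀ t' ∈ Ioo τ₁ τ₂, ∀ x ∈ Icc b c, |w0 t' x - w0 t x| ≤ N * |t' - t| := by
    intro t' ht' x hx
    exact (convex_Ioo τ₁ τ₂).norm_image_sub_le_of_norm_hasDerivWithin_le (f := fun t => w0 t x)
      (fun t ht => (h.dt t ht x hx).hasDerivWithinAt) (fun t ht => h.bt t ht x hx) ht ht'
  rw [hasDerivAt_iff_tendsto_slope]
  have hmain : Tendsto (fun t' => (∫ x in b..c, 1 / 2 * ((w0 t' x - w0 t x) / (t' - t) * (SS s K w0 w1 w2 t' x + SS s K w0 w1 w2 t x)))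
      - 3 / 2 * (s * (K - c)) * ((w0 t' c - w0 t c) / (t' - t)) * (w1 t' c + w1 t c)) (𝓝[≠] t)
      (𝓝 ((∫ x in b..c, 1 / 2 * (wt t x * (SS s K w0 w1 w2 t x + SS s K w0 w1 w2 t x)))
      - 3 / 2 * (s * (K - c)) * wt t c * (w1 t c + w1 t c))) := by
    refine Tendsto.sub ?_ ?_
    · refine intervalIntegral.tendsto_integral_filter_of_dominated_convergence (fun _ => 1/2 * (N * (Q + Q))) ?_ ?_ ?_ ?_
      · filter_upwards [hnh] with t' ht'
        rw [uIoc_of_le hbc]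
        refine ContinuousOn.aestronglyMeasurable (ContinuousOn.mono ?_ Ioc_subset_Icc_self) measurableSet_Ioc
        have aS := SS_cont h s K ht
        have aS' := SS_cont h s K ht'
        have c0 : ∀ t ∈ Ioo τ₁ τ₂, ContinuousOn (w0 t) (Icc b c) := 
          fun t ht x hx => (h.d0 t ht x hx).continuousAt.continuousWithinAt
        have a0 := c0 t ht
        have a0' := c0 t' ht'
        fun_prop
      · filter_upwards [hnh, self_mem_nhdsWithin] with t' ht' hne
        refine Eventually.of_forall fun x hx => ?_
        rw [uIoc_of_le hbc] at hx
        have hx := Ioc_subset_Icc_self hx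
        have hpos : 0 < |t' - t| := abs_pos.2 (sub_ne_zero.2 hne)
        rw [Real.norm_eq_abs, abs_mul, abs_mul]
        have e1 : |(w0 t' x - w0 t x) / (t' - t)| ≤ N := by
          rw [abs_div, div_le_iff₀ hpos]; exact hlip t' ht' x hx
        have e2 : |SS s K w0 w1 w2 t' x + SS s K w0 w1 w2 t x| ≤ Q + Q :=
          (abs_add_le _ _).trans (add_le_add (hQ t' ht' x hx) (hQ t ht x hx))
        have e3 : |(1:ℝ)/2| = 1/2 := by norm_num
        rw [e3]
        have hN : 0 ≤ N := (abs_nonneg _).trans (h.b0 t ht c hcm)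
        gcongr
      · exact intervalIntegrable_const
      · refine Eventually.of_forall fun x hx => ?_
        rw [uIoc_of_le hbc] at hx
        have hx := Ioc_subset_Icc_self hx
        refine ((hslope x hx).mul (Tendsto.add ?_ tendsto_const_nhds)).const_mul _
        exact (hSt x hx).tendsto.mono_left nhdsWithin_le_nhds
    · refine ((hslope c hcm).const_mul _).mul (Tendsto.add ?_ tendsto_const_nhds)
      exact ((h.ct1 c hcm).continuousAt (Ioo_mem_nhds ht.1 ht.2)).tendsto.mono_left nhdsWithin_le_nhds
  have e1 : (∫ x in b..c, 1 / 2 * (wt t x * (SS s K w0 w1 w2 t x + SS s K w0 w1 w2 t x)))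
      - 3 / 2 * (s * (K - c)) * wt t c * (w1 t c + w1 t c) = 
      (∫ x in b..c, wt t x * SS s K w0 w1 w2 t x) - 3 * (s * (K - c)) * wt t c * w1 t c := by
    congr 1
    · congr 1; ext x; ring
    · ring
  rw [e1] at hmain
  refine hmain.congr' ?_
  filter_upwards [hnh, self_mem_nhdsWithin] with t' ht' hne
  have hne' : t' - t ≠ 0 := sub_ne_zero.2 hne
  rw [slope_def_field, EE_diff hbc h s K ht ht', sub_div (∫ x in b..c, _)]
  congr 1
  · rw [← intervalIntegral.integral_div]
    congr 1; ext x; field_simp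
  · field_simp

noncomputable def BB (s K : ℝ) (w0 w1 w2 : ℝ → ℝ → ℝ) (t x : ℝ) : ℝ :=
  3 / 2 * (s * (K - x)) * w2 t x ^ 2 - 3 * s * w1 t x * w2 t x + (s * (K - x)) ^ 3 * w0 t x * w2 t x
  + 4 * (s * (K - x)) ^ 3 * w1 t x ^ 2 - 6 * s * (s * (K - x)) ^ 2 * w0 t x * w1 t x
  + 3 / 2 * ((s * (K - x)) ^ 5 - (s * (K - x)) * s ^ 2) * w0 t x ^ 2

noncomputable def AA (s K : ℝ) (w0 w1 w3 : ℝ → ℝ → ℝ) (t x : ℝ) : ℝ :=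
  w3 t x + 3 * (s * (K - x)) ^ 2 * w1 t x - 3 * s * (s * (K - x)) * w0 t x

noncomputable def PP (s K : ℝ) (w0 w1 w2 : ℝ → ℝ → ℝ) (t x : ℝ) : ℝ :=
  9 / 2 * s * w2 t x ^ 2 + 9 * s * (s * (K - x)) ^ 2 * w1 t x ^ 2
    + (9 / 2 * s * (s * (K - x)) ^ 4 - 3 / 2 * s ^ 3) * w0 t x ^ 2

theorem BB_deriv {w0 w1 w2 w3 : ℝ → ℝ → ℝ} (s K : ℝ) {t x : ℝ}
    (h0 : HasDerivAt (w0 t) (w1 t x) x) (h1 : HasDerivAt (w1 t) (w2 t x) x)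
    (h2 : HasDerivAt (w2 t) (w3 t x) x) :
    HasDerivAt (BB s K w0 w1 w2 t) (AA s K w0 w1 w3 t x * SS s K w0 w1 w2 t x
      - PP s K w0 w1 w2 t x) x := by
  have ha : HasDerivAt (fun x : ℝ => s * (K - x)) (s * (-1)) x :=
        (((hasDerivAt_id x).const_sub K).const_mul s)
  have := ((((((ha.const_mul (3/2)).mul (h2.pow 2)).sub ((h1.const_mul (3 * s)).mul h2)).add
    (((ha.pow 3).mul h0).mul h2)).add (((ha.pow 3).const_mul 4).mul (h1.pow 2))).sub
    ((((ha.pow 2).const_mul (6 * s)).mul h0).mul h1)).add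
    ((((ha.pow 5).sub (ha.mul_const (s ^ 2))).const_mul (3 / 2)).mul (h0.pow 2))
  refine this.congr_deriv ?_
  simp only [AA, SS, PP, Pi.mul_apply, Pi.sub_apply, Pi.add_apply, Pi.pow_apply]
  push_cast
  ring

theorem ptwise (s a m C w0 w1 w2 wt A S P : ℝ) (hs : 1 ≤ s) (ha : s ≤ a) (hm : 0 ≤ m)
    (hC : C ^ 2 ≤ s) (hsm : 6 * m ≤ s) (hf : (wt + A + S) ^ 2 ≤ C ^ 2 * (w1 + a * w0) ^ 2)
    (hP : P = 9 / 2 * s * w2 ^ 2 + 9 * s * a ^ 2 * w1 ^ 2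
    + (9 / 2 * s * a ^ 4 - 3 / 2 * s ^ 3) * w0 ^ 2) :
    wt * S + (A * S - P) + 2 * s * m * (a ^ 3 * w0 ^ 2 + 3 * a * w1 ^ 2) + w0 ^ 2 ≤ 0 := by
  have h1 : wt * S + A * S ≤ (wt + A + S) ^ 2 / 4 := by nlinarith [sq_nonneg (wt + A - S)]
  have h2 : (w1 + a * w0) ^ 2 ≤ 2 * (w1 ^ 2 + a ^ 2 * w0 ^ 2) := by nlinarith [sq_nonneg (w1 - a * w0)]
  have h3 : C ^ 2 * (w1 + a * w0) ^ 2 ≤ s * (2 * (w1 ^ 2 + a ^ 2 * w0 ^ 2)) :=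
    mul_le_mul hC h2 (sq_nonneg _) (by linarith)
  have ha1 : 1 ≤ a := hs.trans ha
  have e1 : 6 * s * m * a ≤ s * a ^ 2 := by
    have : 6 * m ≤ a := hsm.trans ha
    have : 6 * m * (s * a) ≤ a * (s * a) := mul_le_mul_of_nonneg_right this (by positivity)
    nlinarith
  have e2 : 6 * s * m * a ^ 3 ≤ s * a ^ 4 := by
    have : 6 * m ≤ a := hsm.trans ha
    have : 6 * m * (s * a ^ 3) ≤ a * (s * a ^ 3) := mul_le_mul_of_nonneg_right this (by positivity)
    nlinarith
  have e3 : s ≤ s * a ^ 2 := by nlinarith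
  have hs2 : s ^ 2 ≤ a ^ 2 := by gcongr
  have ha2 : 1 ≤ a ^ 2 := by nlinarith
  have e4 : s ^ 3 ≤ s * a ^ 4 := by
    have : a ^ 2 ≤ a ^ 4 := by nlinarith
    have : s * s ^ 2 ≤ s * a ^ 4 := mul_le_mul_of_nonneg_left (hs2.trans this) (by linarith)
    nlinarith
  have e5 : s * a ^ 2 ≤ s * a ^ 4 := by
    have : a ^ 2 ≤ a ^ 4 := by nlinarith
    exact mul_le_mul_of_nonneg_left this (by linarith)
  have e6 : 1 ≤ s * a ^ 4 := by linarith
  have f1 : 0 ≤ (9 * s * a ^ 2 - s / 2 - 6 * s * m * a) * w1 ^ 2 := 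
    mul_nonneg (by nlinarith) (sq_nonneg _)
  have f2 : 0 ≤ (9 / 2 * s * a ^ 4 - 3 / 2 * s ^ 3 - s * a ^ 2 / 2 - 2 * s * m * a ^ 3 - 1) * w0 ^ 2 := 
    mul_nonneg (by nlinarith) (sq_nonneg _)
  have f3 : 0 ≤ 9 / 2 * s * w2 ^ 2 := by positivity
  subst hP
  nlinarith

theorem energy {b c τ₁ τ₂ N : ℝ} {w0 w1 w2 w3 wt : ℝ → ℝ → ℝ} (hbc : b ≤ c)
    (h : Tame b c τ₁ τ₂ N w0 w1 w2 wt) {s m C : ℝ} {t : ℝ} (ht : t ∈ Ioo τ₁ τ₂)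
    (d2 : ∀ x ∈ Icc b c, HasDerivAt (w2 t) (w3 t x) x)
    (c3 : ContinuousOn (w3 t) (Icc b c)) (ctt : ContinuousOn (wt t) (Icc b c))
    (hs : 1 ≤ s) (hm : 0 ≤ m)
    (hC : C ^ 2 ≤ s) (hsm : 6 * m ≤ s)
    (hf : ∀ x ∈ Icc b c, (wt t x + AA s (c + 1) w0 w1 w3 t x + SS s (c + 1) w0 w1 w2 t x) ^ 2
      ≤ C ^ 2 * (w1 t x + (s * ((c + 1) - x)) * w0 t x) ^ 2) :
    (∫ x in b..c, wt t x * SS s (c + 1) w0 w1 w2 t x) + BB s (c + 1) w0 w1 w2 t c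
      + 4 * s * m * |EE s (c + 1) b c w0 w1 t| + ∫ x in b..c, w0 t x ^ 2 ≤ 0 := by
  set K := c + 1 with hK
  have a0 : ContinuousOn (w0 t) (Icc b c) := fun x hx => (h.d0 t ht x hx).continuousAt.continuousWithinAt
  have a1 : ContinuousOn (w1 t) (Icc b c) := fun x hx => (h.d1 t ht x hx).continuousAt.continuousWithinAt
  have a2 := h.c2 t ht
  have aS := SS_cont h s K ht
  have aA : ContinuousOn (AA s K w0 w1 w3 t) (Icc b c) := by unfold AA; fun_prop
  have aP : ContinuousOn (PP s K w0 w1 w2 t) (Icc b c) := by unfold PP; fun_prop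
  have II : ∀ f : ℝ → ℝ, ContinuousOn f (Icc b c) → IntervalIntegrable f volume b c := by
    intro f hf
    apply ContinuousOn.intervalIntegrable
    rwa [uIcc_of_le hbc]
  have hB : ∫ x in b..c, (AA s K w0 w1 w3 t x * SS s K w0 w1 w2 t x - PP s K w0 w1 w2 t x)
      = BB s K w0 w1 w2 t c := by
    rw [intervalIntegral.integral_eq_sub_of_hasDerivAt (f := BB s K w0 w1 w2 t)]
    · have : BB s K w0 w1 w2 t b = 0 := by
        simp [BB, h.z0 t ht, h.z1 t ht, h.z2 t ht]
      rw [this, sub_zero]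
    · intro x hx
      rw [uIcc_of_le hbc] at hx
      exact BB_deriv s K (h.d0 t ht x hx) (h.d1 t ht x hx) (d2 x hx)
    · exact II _ (by fun_prop)
  have hE : |EE s K b c w0 w1 t| ≤ ∫ x in b..c, 1 / 2 * ((s * (K - x)) ^ 3 * w0 t x ^ 2 + 3 * (s * (K - x)) * w1 t x ^ 2) := by
    unfold EE
    refine (intervalIntegral.abs_integral_le_integral_abs hbc).trans ?_
    refine intervalIntegral.integral_mono_on hbc (II _ (by fun_prop)) (II _ (by fun_prop)) ?_
    intro x hx
    have hKx : 1 ≤ K - x := by have := hx.2; linarith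
    have p1 : 0 ≤ (s * (K - x)) ^ 3 * w0 t x ^ 2 := by positivity
    have p2 : 0 ≤ 3 * (s * (K - x)) * w1 t x ^ 2 := by positivity
    rw [abs_le]
    constructor <;> linarith
  have hI : (∫ x in b..c, wt t x * SS s K w0 w1 w2 t x) + (∫ x in b..c, (AA s K w0 w1 w3 t x * SS s K w0 w1 w2 t x - PP s K w0 w1 w2 t x))
     + (4 * s * m) * (∫ x in b..c, 1 / 2 * ((s * (K - x)) ^ 3 * w0 t x ^ 2 + 3 * (s * (K - x)) * w1 t x ^ 2)) + ∫ x in b..c, w0 t x ^ 2 ≤ 0 := by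
    rw [← intervalIntegral.integral_const_mul, ← intervalIntegral.integral_add, ← intervalIntegral.integral_add, ← intervalIntegral.integral_add]
    · refine (intervalIntegral.integral_mono_on (g := fun _ => (0:ℝ)) hbc (II _ (by fun_prop)) (II _ (by fun_prop)) ?_).trans (by simp)
      intro x hx
      have hKx : 1 ≤ K - x := by have := hx.2; linarith
      have := ptwise s (s * (K - x)) m C (w0 t x) (w1 t x) (w2 t x) (wt t x) (AA s K w0 w1 w3 t x) (SS s K w0 w1 w2 t x)
        (PP s K w0 w1 w2 t x) hs (by nlinarith) hm hC hsm (hf x hx) rfl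
      linarith
    all_goals exact II _ (by fun_prop)
  have : 4 * s * m * |EE s K b c w0 w1 t| ≤ 4 * s * m * _ := mul_le_mul_of_nonneg_left hE (by positivity)
  rw [hB] at hI
  linarith

noncomputable def ee (s K x : ℝ) : ℝ := Real.exp (s / 2 * (K - x) ^ 2)

noncomputable def W0 (s K : ℝ) (u0 : ℝ → ℝ → ℝ) (t x : ℝ) : ℝ := ee s K x * u0 t x
noncomputable def W1 (s K : ℝ) (u0 u1 : ℝ → ℝ → ℝ) (t x : ℝ) : ℝ :=
  ee s K x * (u1 t x - (s * (K - x)) * u0 t x)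
noncomputable def W2 (s K : ℝ) (u0 u1 u2 : ℝ → ℝ → ℝ) (t x : ℝ) : ℝ :=
  ee s K x * (u2 t x - 2 * (s * (K - x)) * u1 t x + ((s * (K - x)) ^ 2 + s) * u0 t x)
noncomputable def W3 (s K : ℝ) (u0 u1 u2 u3 : ℝ → ℝ → ℝ) (t x : ℝ) : ℝ :=
  ee s K x * (u3 t x - 3 * (s * (K - x)) * u2 t x + (3 * (s * (K - x)) ^ 2 + 3 * s) * u1 t x
    - ((s * (K - x)) ^ 3 + 3 * s * (s * (K - x))) * u0 t x)

theorem ee_deriv (s K x : ℝ) : HasDerivAt (ee s K) (-(s * (K - x)) * ee s K x) x := by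
  have ha : HasDerivAt (fun x : ℝ => (K - x)) (-1) x := ((hasDerivAt_id x).const_sub K)
  refine (((ha.pow 2).const_mul (s / 2)).exp).congr_deriv ?_
  simp only [ee, Pi.pow_apply]
  push_cast
  ring

theorem a_deriv (s K x : ℝ) : HasDerivAt (fun x : ℝ => s * (K - x)) (-s) x :=
  (((hasDerivAt_id x).const_sub K).const_mul s).congr_deriv (by ring)

theorem ee_sq (s K x : ℝ) : ee s K x ^ 2 = Real.exp (s * (K - x) ^ 2) := by
  unfold ee
  rw [← Real.exp_nat_mul]; congr 1; push_cast; ring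

theorem W0_deriv {u0 u1 : ℝ → ℝ → ℝ} (s K : ℝ) {t x : ℝ}
    (h0 : HasDerivAt (u0 t) (u1 t x) x) : HasDerivAt (W0 s K u0 t) (W1 s K u0 u1 t x) x := by
  refine ((ee_deriv s K x).mul h0).congr_deriv ?_
  simp only [W1]; ring

theorem W1_deriv {u0 u1 u2 : ℝ → ℝ → ℝ} (s K : ℝ) {t x : ℝ}
    (h0 : HasDerivAt (u0 t) (u1 t x) x) (h1 : HasDerivAt (u1 t) (u2 t x) x) :
    HasDerivAt (W1 s K u0 u1 t) (W2 s K u0 u1 u2 t x) x := by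
  refine ((ee_deriv s K x).mul (h1.sub ((a_deriv s K x).mul h0))).congr_deriv ?_
  simp only [W2, Pi.mul_apply, Pi.sub_apply]; ring

theorem W2_deriv {u0 u1 u2 u3 : ℝ → ℝ → ℝ} (s K : ℝ) {t x : ℝ}
    (h0 : HasDerivAt (u0 t) (u1 t x) x) (h1 : HasDerivAt (u1 t) (u2 t x) x)
    (h2 : HasDerivAt (u2 t) (u3 t x) x) :
    HasDerivAt (W2 s K u0 u1 u2 t) (W3 s K u0 u1 u2 u3 t x) x := by
  have ha := a_deriv s K x
  refine ((ee_deriv s K x).mul ((h2.sub ((ha.const_mul 2).mul h1)).add 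
    (((ha.pow 2).add_const s).mul h0))).congr_deriv ?_
  simp only [W3, Pi.mul_apply, Pi.sub_apply, Pi.add_apply, Pi.pow_apply]
  push_cast
  ring

theorem W_eq (s K : ℝ) (u0 u1 u2 u3 ut : ℝ → ℝ → ℝ) (t x : ℝ) :
    W0 s K ut t x + AA s K (W0 s K u0) (W1 s K u0 u1) (W3 s K u0 u1 u2 u3) t x
      + SS s K (W0 s K u0) (W1 s K u0 u1) (W2 s K u0 u1 u2) t x = ee s K x * (ut t x + u3 t x) := by
  simp only [W0, W1, W2, W3, AA, SS]; ring

theorem ee_cont (s K : ℝ) : Continuous (ee s K) := by unfold ee; fun_prop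

theorem W_tame {b c τ₁ τ₂ N : ℝ} {u0 u1 u2 ut : ℝ → ℝ → ℝ} (hbc : b ≤ c) (hN : 0 ≤ N)
    (h : Tame b c τ₁ τ₂ N u0 u1 u2 ut) {s : ℝ} (hs : 1 ≤ s) :
    ∃ N', Tame b c τ₁ τ₂ N' (W0 s (c + 1) u0) (W1 s (c + 1) u0 u1) (W2 s (c + 1) u0 u1 u2) (W0 s (c + 1) ut) := by
  set K := c + 1 with hK
  set D := K - b with hD
  have hec := ee_cont s K
  have hD1 : 1 ≤ D := by linarith
  have he : ∀ x ∈ Icc b c, |ee s K x| ≤ Real.exp (s / 2 * D ^ 2) := by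
    intro x hx
    unfold ee
    rw [abs_of_pos (Real.exp_pos _)]
    apply Real.exp_le_exp.2
    have h1 : 0 ≤ K - x := by linarith [hx.2]
    have h2 : K - x ≤ D := by linarith [hx.1]
    gcongr
  have ha : ∀ x ∈ Icc b c, |s * (K - x)| ≤ s * D := by
    intro x hx
    have h1 : 0 ≤ K - x := by linarith [hx.2]
    have h2 : K - x ≤ D := by linarith [hx.1]
    rw [abs_of_nonneg (by positivity)]
    gcongr
  have hX : 0 ≤ Real.exp (s / 2 * D ^ 2) := (Real.exp_pos _).le
  have hsD : 0 ≤ s * D := by positivity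
  have hbig : N ≤ N + 2 * (s * D) * N + ((s * D) ^ 2 + s) * N := by
    have : 0 ≤ 2 * (s * D) * N := by positivity
    have : 0 ≤ ((s * D) ^ 2 + s) * N := by positivity
    linarith
  refine ⟨Real.exp (s / 2 * D ^ 2) * (N + 2 * (s * D) * N + ((s * D) ^ 2 + s) * N), ?_⟩
  constructor
  · exact fun t ht x hx => W0_deriv s K (h.d0 t ht x hx)
  · exact fun t ht x hx => W1_deriv s K (h.d0 t ht x hx) (h.d1 t ht x hx)
  · intro t ht
    have a0 : ContinuousOn (u0 t) (Icc b c) := fun x hx => (h.d0 t ht x hx).continuousAt.continuousWithinAt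
    have a1 : ContinuousOn (u1 t) (Icc b c) := fun x hx => (h.d1 t ht x hx).continuousAt.continuousWithinAt
    have a2 := h.c2 t ht
    unfold W2
    fun_prop
  · exact fun t ht x hx => (h.dt t ht x hx).const_mul _
  · intro x hx
    have a0 : ContinuousOn (fun t => u0 t x) (Ioo τ₁ τ₂) := fun t ht => (h.dt t ht x hx).continuousAt.continuousWithinAt
    have a1 := h.ct1 x hx
    unfold W1
    fun_prop
  · intro x hx
    have a0 : ContinuousOn (fun t => u0 t x) (Ioo τ₁ τ₂) := fun t ht => (h.dt t ht x hx).continuousAt.continuousWithinAt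
    have a1 := h.ct1 x hx
    have a2 := h.ct2 x hx
    unfold W2
    fun_prop
  · intro t ht x hx
    unfold W0
    rw [abs_mul]
    exact mul_le_mul (he x hx) ((h.b0 t ht x hx).trans hbig) (abs_nonneg _) hX
  · intro t ht x hx
    unfold W1
    rw [abs_mul]
    refine mul_le_mul (he x hx) ((abs_sub _ _).trans ?_) (abs_nonneg _) hX
    rw [abs_mul]
    have e1 := h.b1 t ht x hx
    have e2 : |s * (K - x)| * |u0 t x| ≤ (s * D) * N :=  mul_le_mul (ha x hx) (h.b0 t ht x hx) (abs_nonneg _) hsD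
    have : 0 ≤ (s * D) * N := by positivity
    have : 0 ≤ ((s * D) ^ 2 + s) * N := by positivity
    linarith
  · intro t ht x hx
    unfold W2
    rw [abs_mul]
    refine mul_le_mul (he x hx) ((abs_add_le _ _).trans (add_le_add ((abs_sub _ _).trans (add_le_add (h.b2 t ht x hx) ?_)) ?_)) (abs_nonneg _) hX
    · rw [abs_mul, abs_mul, abs_two]
      have := ha x hx
      have := h.b1 t ht x hx
      gcongr
    · rw [abs_mul, abs_of_nonneg (a := (s * (K - x)) ^ 2 + s) (by positivity), ← sq_abs (s * (K - x))]
      have := ha x hx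
      have := h.b0 t ht x hx
      gcongr
  · intro t ht x hx
    unfold W0
    rw [abs_mul]
    exact mul_le_mul (he x hx) ((h.bt t ht x hx).trans hbig) (abs_nonneg _) hX
  · intro t ht
    simp [W0, h.z0 t ht]
  · intro t ht
    simp [W1, h.z0 t ht, h.z1 t ht]
  · intro t ht
    simp [W2, h.z0 t ht, h.z1 t ht, h.z2 t ht]

theorem mulb {p q P Q : ℝ} (hp : |p| ≤ P) (hq : |q| ≤ Q) : |p * q| ≤ P * Q := by
  rw [abs_mul]; exact mul_le_mul hp hq (abs_nonneg _) ((abs_nonneg _).trans hp)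

theorem Rbound (s X w0 w1 w2 wt : ℝ) (hs : 1 ≤ s) (h0 : |w0| ≤ X)
    (h1 : |w1| ≤ 2 * s * X) (h2 : |w2| ≤ 5 * s ^ 2 * X) (ht : |wt| ≤ X) :
    -(3 / 2 * s * w2 ^ 2 - 3 * s * w1 * w2 + s ^ 3 * w0 * w2
  + 4 * s ^ 3 * w1 ^ 2 - 6 * s * s ^ 2 * w0 * w1
  + 3 / 2 * (s ^ 5 - s * s ^ 2) * w0 ^ 2) - 3 * s * wt * w1 ≤ 200 * s ^ 5 * X ^ 2 := by
  have hX : 0 ≤ X := (abs_nonneg _).trans h0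
  have s0 : 0 ≤ s := by linarith
  have p1 : s * (w1 * w2) ≤ s * (2 * s * X * (5 * s ^ 2 * X)) :=
    mul_le_mul_of_nonneg_left (abs_le.1 (mulb h1 h2)).2 s0
  have p2 : s ^ 3 * -(w0 * w2) ≤ s ^ 3 * (X * (5 * s ^ 2 * X)) :=
    mul_le_mul_of_nonneg_left (by linarith [(abs_le.1 (mulb h0 h2)).1]) (by positivity)
  have p3 : s ^ 3 * (w0 * w1) ≤ s ^ 3 * (X * (2 * s * X)) :=
    mul_le_mul_of_nonneg_left (abs_le.1 (mulb h0 h1)).2 (by positivity)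
  have p4 : s * -(wt * w1) ≤ s * (X * (2 * s * X)) :=
    mul_le_mul_of_nonneg_left (by linarith [(abs_le.1 (mulb ht h1)).1]) (by positivity)
  have p5 : 0 ≤ s * w2 ^ 2 := by positivity
  have p6 : 0 ≤ s ^ 3 * w1 ^ 2 := by positivity
  have q1 : s ^ 3 ≤ s ^ 5 := pow_le_pow_right₀ hs (by norm_num)
  have q2 : s ^ 4 ≤ s ^ 5 := pow_le_pow_right₀ hs (by norm_num)
  have q3 : s ^ 2 ≤ s ^ 5 := pow_le_pow_right₀ hs (by norm_num)
  have p7 : 0 ≤ (s ^ 5 - s * s ^ 2) * w0 ^ 2 := mul_nonneg (by nlinarith) (sq_nonneg _)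
  have r2 : s ^ 4 * X ^ 2 ≤ s ^ 5 * X ^ 2 := by gcongr
  have r3 : s ^ 2 * X ^ 2 ≤ s ^ 5 * X ^ 2 := by gcongr
  have r4 : 0 ≤ s ^ 5 * X ^ 2 := by positivity
  nlinarith

theorem arith1 {s N : ℝ} (hs : 1 ≤ s) (hN : 0 ≤ N) : N + s * N ≤ 2 * s * N := by nlinarith

theorem arith2 {s N : ℝ} (hs : 1 ≤ s) (hN : 0 ≤ N) : N + 2 * s * N + (s ^ 2 + s) * N ≤ 5 * s ^ 2 * N := by
  have q1 : s * N ≤ s ^ 2 * N := by gcongr; nlinarith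
  have q2 : N ≤ s ^ 2 * N := by nlinarith
  linarith

set_option maxHeartbeats 4000000 in
theorem key {b c τ₁ τ₂ N C : ℝ} {u0 u1 u2 u3 ut : ℝ → ℝ → ℝ} (hbc : b ≤ c) (hN : 0 ≤ N)
    (h : Tame b c τ₁ τ₂ N u0 u1 u2 ut)
    (d2 : ∀ t ∈ Ioo τ₁ τ₂, ∀ x ∈ Icc b c, HasDerivAt (u2 t) (u3 t x) x)
    (c3 : ∀ t ∈ Ioo τ₁ τ₂, ContinuousOn (u3 t) (Icc b c))
    (ctt : ∀ t ∈ Ioo τ₁ τ₂, ContinuousOn (ut t) (Icc b c))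
    (hP : ∀ t ∈ Ioo τ₁ τ₂, ∀ x ∈ Icc b c, |ut t x + u3 t x| ≤ C * |u1 t x|)
    {s m μ δ r κ t₀ xs : ℝ} (hs : 1 ≤ s) (hC : C ^ 2 ≤ s) (hsm : 6 * m ≤ s)
    (hμ : 0 ≤ μ) (hδ : 0 < δ) (hm : m = μ * δ / 2) (hμδ : μ * δ ^ 2 = (c + 1 - b) ^ 2)
    (hJ : Icc (t₀ - δ) (t₀ + δ) ⊆ Ioo τ₁ τ₂) (hr : 0 < r) (hrδ : r < δ) (hκ : 0 ≤ κ)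
    (hxs : b ≤ xs) (hxr : xs + r ≤ c)
    (hbox : ∀ t ∈ Icc (t₀ - r) (t₀ + r), ∀ x ∈ Icc xs (xs + r), κ ≤ u0 t x ^ 2) :
    2 * r * (r * κ * Real.exp (s * ((c + 1 - xs - r) ^ 2 - μ * r ^ 2))) ≤
      2 * δ * (200 * s ^ 5 * (N ^ 2 * Real.exp s)) + 14 * s ^ 3 * (c + 1 - b) ^ 4 * N ^ 2 := by
  obtain ⟨N', hW⟩ := W_tame hbc hN h hs
  have hcm : c ∈ Icc b c := ⟨hbc, le_rfl⟩
  have hm0 : 0 ≤ m := by rw [hm]; positivity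
  set K := c + 1 with hK
  set D := K - b with hD
  have hD1 : 1 ≤ D := by linarith
  set E := EE s K b c (W0 s K u0) (W1 s K u0 u1) with hE
  set R := 200 * s ^ 5 * (N ^ 2 * Real.exp s) with hR
  have hR0 : 0 ≤ R := by positivity
  have II : ∀ f : ℝ → ℝ, ContinuousOn f (Icc b c) → IntervalIntegrable f volume b c := by
    intro f hf
    apply ContinuousOn.intervalIntegrable
    rwa [uIcc_of_le hbc]
  -- derivative bound of E
  have hE' : ∀ t ∈ Ioo τ₁ τ₂, ∃ E', HasDerivAt E E' t ∧ 
      E' + 4 * s * m * |E t| + (∫ x in b..c, W0 s K u0 t x ^ 2) ≤ R := by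
    intro t ht
    refine ⟨_, EE_deriv hbc hW s K ht, ?_⟩
    have hen := energy (w3 := W3 s K u0 u1 u2 u3) (C := C) (m := m) (s := s) hbc hW ht
      (fun x hx => W2_deriv s K (h.d0 t ht x hx) (h.d1 t ht x hx) (d2 t ht x hx)) (by
        have a0 : ContinuousOn (u0 t) (Icc b c) := fun x hx => (h.d0 t ht x hx).continuousAt.continuousWithinAt
        have a1 : ContinuousOn (u1 t) (Icc b c) := fun x hx => (h.d1 t ht x hx).continuousAt.continuousWithinAt
        have a2 := h.c2 t ht
        have a3 := c3 t ht
        have hec := ee_cont s (c+1)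
        unfold W3
        fun_prop) (by
        have hec := ee_cont s (c+1)
        have := ctt t ht
        unfold W0
        fun_prop) hs hm0 hC hsm (by
        intro x hx
        rw [W_eq]
        have e1 : W1 s (c + 1) u0 u1 t x + s * (c + 1 - x) * W0 s (c + 1) u0 t x = ee s (c + 1) x * u1 t x := by
          simp only [W1, W0]; ring
        rw [e1, mul_pow, mul_pow]
        have e2 : (ut t x + u3 t x) ^ 2 ≤ C ^ 2 * u1 t x ^ 2 := by
          have := pow_le_pow_left₀ (abs_nonneg _) (hP t ht x hx) 2
          rwa [sq_abs, mul_pow, sq_abs] at this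
        have := mul_le_mul_of_nonneg_left e2 (sq_nonneg (ee s (c + 1) x))
        linarith)
    have hRb := Rbound s (N * Real.exp (s / 2)) (W0 s K u0 t c) (W1 s K u0 u1 t c) (W2 s K u0 u1 u2 t c)
      (W0 s K ut t c) hs
    have hKc : K - c = 1 := by rw [hK]; ring
    have hec : ee s K c = Real.exp (s / 2) := by simp [ee, hKc]
    have hep := Real.exp_pos (s / 2)
    have b0 := h.b0 t ht c hcm
    have b1 := h.b1 t ht c hcm
    have b2 := h.b2 t ht c hcm
    have bt := h.bt t ht c hcm
    have hRb := hRb (by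
        simp only [W0]; rw [hec, abs_mul, abs_of_pos hep, mul_comm]; gcongr) (by
        simp only [W1]; rw [hec, hKc, abs_mul, abs_of_pos hep]
        have : |u1 t c - s * 1 * u0 t c| ≤ N + s * N := by
          refine (abs_sub _ _).trans ?_
          rw [mul_one, abs_mul, abs_of_pos (a := s) (by linarith)]
          gcongr
        have : |u1 t c - s * 1 * u0 t c| ≤ 2 * s * N := this.trans (arith1 hs hN)
        have := mul_le_mul_of_nonneg_left this hep.le
        linarith) (by
        simp only [W2]; rw [hec, hKc, abs_mul, abs_of_pos hep]
        have : |u2 t c - 2 * (s * 1) * u1 t c + ((s * 1) ^ 2 + s) * u0 t c| ≤ N + 2 * s * N + (s ^ 2 + s) * N := by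
          refine (abs_add_le _ _).trans (add_le_add ((abs_sub _ _).trans (add_le_add b2 ?_)) ?_)
          · rw [mul_one, abs_mul, abs_of_pos (a := 2 * s) (by linarith)]
            gcongr
          · rw [mul_one, abs_mul, abs_of_pos (a := s ^ 2 + s) (by positivity)]
            gcongr
        have : |u2 t c - 2 * (s * 1) * u1 t c + ((s * 1) ^ 2 + s) * u0 t c| ≤ 5 * s ^ 2 * N := this.trans (arith2 hs hN)
        have := mul_le_mul_of_nonneg_left this hep.le
        linarith) (by
        simp only [W0]; rw [hec, abs_mul, abs_of_pos hep, mul_comm]; gcongr)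
    have hXR : 200 * s ^ 5 * (N * Real.exp (s / 2)) ^ 2 = R := by
      rw [hR, mul_pow, ← Real.exp_nat_mul]
      congr 4; push_cast; ring
    rw [hXR] at hRb
    have hBB : BB s K (W0 s K u0) (W1 s K u0 u1) (W2 s K u0 u1 u2) t c = 
      (3 / 2 * s * (W2 s K u0 u1 u2 t c) ^ 2 - 3 * s * (W1 s K u0 u1 t c) * (W2 s K u0 u1 u2 t c) + s ^ 3 * (W0 s K u0 t c) * (W2 s K u0 u1 u2 t c)
  + 4 * s ^ 3 * (W1 s K u0 u1 t c) ^ 2 - 6 * s * s ^ 2 * (W0 s K u0 t c) * (W1 s K u0 u1 t c)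
  + 3 / 2 * (s ^ 5 - s * s ^ 2) * (W0 s K u0 t c) ^ 2) := by
      simp only [BB, hKc, mul_one]
    rw [← hBB] at hRb
    rw [hKc, mul_one]
    linarith
  -- bound of E
  have hEb : ∀ t ∈ Ioo τ₁ τ₂, |E t| ≤ 7 * s ^ 3 * D ^ 4 * N ^ 2 * Real.exp (s * D ^ 2) := by
    intro t ht
    have := intervalIntegral.norm_integral_le_of_norm_le_const (a := b) (b := c)
      (f := fun x => (1 / 2 * ((s * (K - x)) ^ 3 * W0 s K u0 t x ^ 2 - 3 * (s * (K - x)) * W1 s K u0 u1 t x ^ 2)))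
      (C := 7 * s ^ 3 * D ^ 3 * N ^ 2 * Real.exp (s * D ^ 2)) (by
        intro x hx
        rw [uIoc_of_le hbc] at hx
        have hx := Ioc_subset_Icc_self hx
        have h1 : 1 ≤ K - x := by linarith [hx.2]
        have h2 : K - x ≤ D := by linarith [hx.1]
        have ha : 1 ≤ s * (K - x) := by nlinarith
        have haD : s * (K - x) ≤ s * D := by gcongr
        set a := s * (K - x) with hadef
        have he2 : ee s K x ^ 2 ≤ Real.exp (s * D ^ 2) := by
          rw [ee_sq]; apply Real.exp_le_exp.2; gcongr
        have v0 : u0 t x ^ 2 ≤ N ^ 2 := by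
          rw [← sq_abs]; exact pow_le_pow_left₀ (abs_nonneg _) (h.b0 t ht x hx) 2
        have v1 : u1 t x ^ 2 ≤ N ^ 2 := by
          rw [← sq_abs]; exact pow_le_pow_left₀ (abs_nonneg _) (h.b1 t ht x hx) 2
        have w0 : W0 s K u0 t x ^ 2 ≤ Real.exp (s * D ^ 2) * N ^ 2 := by
          unfold W0; rw [mul_pow]; gcongr
        have w1 : W1 s K u0 u1 t x ^ 2 ≤ Real.exp (s * D ^ 2) * (4 * a ^ 2 * N ^ 2) := by
          unfold W1; rw [mul_pow, ← hadef]
          have : (u1 t x - a * u0 t x) ^ 2 ≤ 4 * a ^ 2 * N ^ 2 := by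
            have q1 : a ^ 2 * u0 t x ^ 2 ≤ a ^ 2 * N ^ 2 := by gcongr
            have q2 : N ^ 2 ≤ a ^ 2 * N ^ 2 := le_mul_of_one_le_left (sq_nonneg N) (one_le_pow₀ ha)
            nlinarith [sq_nonneg (u1 t x + a * u0 t x)]
          gcongr
        have a0 : 0 ≤ a := by linarith
        have z0 : a ^ 3 * W0 s K u0 t x ^ 2 ≤ a ^ 3 * (Real.exp (s * D ^ 2) * N ^ 2) := by gcongr
        have z1 : 3 * a * W1 s K u0 u1 t x ^ 2 ≤ 3 * a * (Real.exp (s * D ^ 2) * (4 * a ^ 2 * N ^ 2)) := by gcongr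
        have z2 : a ^ 3 ≤ s ^ 3 * D ^ 3 := by rw [← mul_pow]; gcongr
        have z3 : a ^ 3 * (Real.exp (s * D ^ 2) * N ^ 2) ≤ s ^ 3 * D ^ 3 * (Real.exp (s * D ^ 2) * N ^ 2) := by gcongr
        have y0 : 0 ≤ a ^ 3 * W0 s K u0 t x ^ 2 := by positivity
        have y1 : 0 ≤ 3 * a * W1 s K u0 u1 t x ^ 2 := by positivity
        have y2 : 0 ≤ a ^ 3 * (Real.exp (s * D ^ 2) * N ^ 2) := by positivity
        rw [Real.norm_eq_abs, abs_le]
        constructor <;> linarith)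
    refine (this : |E t| ≤ _).trans ?_
    rw [abs_of_nonneg (by linarith)]
    have : 7 * s ^ 3 * D ^ 4 * N ^ 2 * Real.exp (s * D ^ 2) = 7 * s ^ 3 * D ^ 3 * N ^ 2 * Real.exp (s * D ^ 2) * D := by ring
    rw [this]
    gcongr
    linarith
  set g : ℝ → ℝ := fun t => Real.exp (-(μ * s * (t - t₀) ^ 2)) with hg
  have hgd : ∀ t, HasDerivAt g (g t * (-(2 * μ * s * (t - t₀)))) t := by
    intro t
    have ha : HasDerivAt (fun t : ℝ => (t - t₀)) 1 t := ((hasDerivAt_id t).sub_const t₀)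
    refine ((((ha.pow 2).const_mul (μ * s)).neg).exp).congr_deriv ?_
    simp only [hg, Pi.neg_apply, Pi.pow_apply]
    push_cast
    ring
  have hgpos : ∀ t, 0 < g t := fun t => Real.exp_pos _
  have hg1 : ∀ t, g t ≤ 1 := fun t => Real.exp_le_one_iff.2 (by simp only [Left.neg_nonpos_iff]; positivity)
  have hG : ∀ t ∈ Icc (t₀ - δ) (t₀ + δ), ∃ G', HasDerivAt (fun t => g t * E t) G' t ∧
      G' ≤ R - g t * ∫ x in b..c, W0 s K u0 t x ^ 2 := by
    intro t ht
    obtain ⟨E', h1, h2⟩ := hE' t (hJ ht)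
    refine ⟨_, (hgd t).mul h1, ?_⟩
    have h3 : -(2 * μ * s * (t - t₀)) * E t ≤ 4 * s * m * |E t| := by
      have e1 : |-(2 * μ * s * (t - t₀))| ≤ 4 * s * m := by
        have : |t - t₀| ≤ δ := abs_le.2 ⟨by linarith [ht.1], by linarith [ht.2]⟩
        rw [abs_neg, abs_mul, abs_of_nonneg (a := 2 * μ * s) (by positivity), hm]
        have : 2 * μ * s * |t - t₀| ≤ 2 * μ * s * δ := by gcongr
        linarith
      exact (le_abs_self _).trans (by rw [abs_mul]; gcongr)
    have h4 : g t * (E' + -(2 * μ * s * (t - t₀)) * E t + ∫ x in b..c, W0 s K u0 t x ^ 2) ≤ g t * R :=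
      mul_le_mul_of_nonneg_left (by linarith) (hgpos t).le
    have h5 : g t * R ≤ R := mul_le_of_le_one_left hR0 (hg1 t)
    linarith
  set G := fun t => g t * E t with hGdef
  set q := r * κ * Real.exp (s * ((K - xs - r) ^ 2 - μ * r ^ 2)) with hq
  have hMV : ∀ Q p p', p ≤ p' → Icc p p' ⊆ Icc (t₀ - δ) (t₀ + δ) → 
      (∀ t ∈ Icc p p', ∀ G', HasDerivAt G G' t → G' ≤ Q) → G p' - G p ≤ Q * (p' - p) := by
    intro Q p p' hpp hsub hQ
    refine (convex_Icc p p').image_sub_le_mul_sub_of_deriv_le ?_ ?_ ?_ p ⟨le_rfl, hpp⟩ p' ⟨hpp, le_rfl⟩ hpp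
    · intro t ht
      obtain ⟨G', h1, _⟩ := hG t (hsub ht)
      exact h1.continuousAt.continuousWithinAt
    · intro t ht
      obtain ⟨G', h1, _⟩ := hG t (hsub (interior_subset ht))
      exact h1.differentiableAt.differentiableWithinAt
    · intro t ht
      obtain ⟨G', h1, _⟩ := hG t (hsub (interior_subset ht))
      exact hQ t (interior_subset ht) _ (h1.differentiableAt.hasDerivAt)
  have hI0 : ∀ t, 0 ≤ ∫ x in b..c, W0 s K u0 t x ^ 2 := fun t =>
    intervalIntegral.integral_nonneg hbc fun x _ => sq_nonneg _
  have hQ1 : ∀ t ∈ Icc (t₀ - δ) (t₀ + δ), ∀ G', HasDerivAt G G' t → G' ≤ R := by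
    intro t ht G' hG'
    obtain ⟨G'', h1, h2⟩ := hG t ht
    rw [hG'.unique h1]
    have := mul_nonneg (hgpos t).le (hI0 t)
    linarith
  have hsubr : Icc (t₀ - r) (t₀ + r) ⊆ Icc (t₀ - δ) (t₀ + δ) := Icc_subset_Icc (by linarith) (by linarith)
  have hQ2 : ∀ t ∈ Icc (t₀ - r) (t₀ + r), ∀ G', HasDerivAt G G' t → G' ≤ R - q := by
    intro t ht G' hG'
    obtain ⟨G'', h1, h2⟩ := hG t (hsubr ht)
    rw [hG'.unique h1]
    have htJ := hJ (hsubr ht)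
    have hcW : ContinuousOn (fun x => W0 s K u0 t x ^ 2) (Icc b c) := by
      have a0 : ContinuousOn (W0 s K u0 t) (Icc b c) := fun x hx => (hW.d0 t htJ x hx).continuousAt.continuousWithinAt
      fun_prop
    have i1 : r * (κ * Real.exp (s * (K - xs - r) ^ 2)) ≤ ∫ x in b..c, W0 s K u0 t x ^ 2 := by
      calc r * (κ * Real.exp (s * (K - xs - r) ^ 2)) = ∫ x in xs..(xs + r), (κ * Real.exp (s * (K - xs - r) ^ 2)) := by
            simp; ring
        _ ≤ ∫ x in xs..(xs + r), W0 s K u0 t x ^ 2 := by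
            refine intervalIntegral.integral_mono_on (by linarith) intervalIntegrable_const ?_ ?_
            · apply ContinuousOn.intervalIntegrable
              rw [uIcc_of_le (by linarith)]
              exact hcW.mono (Icc_subset_Icc hxs hxr)
            · intro x hx
              unfold W0
              rw [mul_pow, ee_sq, mul_comm κ]
              have k1 := hbox t ht x hx
              have k2 : Real.exp (s * (K - xs - r) ^ 2) ≤ Real.exp (s * (K - x) ^ 2) := by
                apply Real.exp_le_exp.2
                have : 0 ≤ K - xs - r := by linarith
                have : K - xs - r ≤ K - x := by linarith [hx.2]
                gcongr
              gcongr
        _ ≤ ∫ x in b..c, W0 s K u0 t x ^ 2 := by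
            refine intervalIntegral.integral_mono_interval hxs (by linarith) hxr ?_ (II _ hcW)
            exact Eventually.of_forall fun x => sq_nonneg _
    have i2 : Real.exp (-(μ * s * r ^ 2)) ≤ g t := by
      apply Real.exp_le_exp.2
      have : (t - t₀) ^ 2 ≤ r ^ 2 := by
        rw [← sq_abs (t - t₀)]
        apply pow_le_pow_left₀ (abs_nonneg _)
        exact abs_le.2 ⟨by linarith [ht.1], by linarith [ht.2]⟩
      have : μ * s * (t - t₀) ^ 2 ≤ μ * s * r ^ 2 := by gcongr
      linarith
    have i3 : q = Real.exp (-(μ * s * r ^ 2)) * (r * (κ * Real.exp (s * (K - xs - r) ^ 2))) := by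
      have : s * ((K - xs - r) ^ 2 - μ * r ^ 2) = -(μ * s * r ^ 2) + s * (K - xs - r) ^ 2 := by ring
      rw [hq, this, Real.exp_add]; ring
    have i4 : q ≤ g t * ∫ x in b..c, W0 s K u0 t x ^ 2 := by
      rw [i3]; exact mul_le_mul i2 i1 (by positivity) (hgpos t).le
    linarith
  have m1 := hMV R (t₀ - δ) (t₀ - r) (by linarith) (Icc_subset_Icc le_rfl (by linarith)) 
    (fun t ht => hQ1 t ⟨ht.1, by linarith [ht.2]⟩)
  have m2 := hMV (R - q) (t₀ - r) (t₀ + r) (by linarith) hsubr hQ2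
  have m3 := hMV R (t₀ + r) (t₀ + δ) (by linarith) (Icc_subset_Icc (by linarith) le_rfl) 
    (fun t ht => hQ1 t ⟨by linarith [ht.1], ht.2⟩)
  have hend : ∀ t ∈ Icc (t₀ - δ) (t₀ + δ), (t - t₀) ^ 2 = δ ^ 2 → |G t| ≤ 7 * s ^ 3 * D ^ 4 * N ^ 2 := by
    intro t ht hd
    have e1 : g t = Real.exp (-(s * D ^ 2)) := by
      simp only [hg]; rw [hd, ← hμδ]; congr 1; ring
    simp only [hGdef]
    rw [abs_mul, abs_of_pos (hgpos t), e1]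
    have := mul_le_mul_of_nonneg_left (hEb t (hJ ht)) (Real.exp_pos (-(s * D ^ 2))).le
    refine this.trans (le_of_eq ?_)
    rw [mul_comm, mul_assoc, ← Real.exp_add]
    simp
  have n1 := hend (t₀ - δ) ⟨le_rfl, by linarith⟩ (by ring)
  have n2 := hend (t₀ + δ) ⟨by linarith, le_rfl⟩ (by ring)
  have n3 := (abs_le.1 n1).2
  have n4 := (abs_le.1 n2).1
  linarith

theorem core {b c τ₁ τ₂ N C : ℝ} {u0 u1 u2 u3 ut : ℝ → ℝ → ℝ} (hbc : b ≤ c) (hN : 0 ≤ N)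
    (h : Tame b c τ₁ τ₂ N u0 u1 u2 ut)
    (d2 : ∀ t ∈ Ioo τ₁ τ₂, ∀ x ∈ Icc b c, HasDerivAt (u2 t) (u3 t x) x)
    (c3 : ∀ t ∈ Ioo τ₁ τ₂, ContinuousOn (u3 t) (Icc b c))
    (ctt : ∀ t ∈ Ioo τ₁ τ₂, ContinuousOn (ut t) (Icc b c))
    (hP : ∀ t ∈ Ioo τ₁ τ₂, ∀ x ∈ Icc b c, |ut t x + u3 t x| ≤ C * |u1 t x|) :
    ∀ t ∈ Ioo τ₁ τ₂, ∀ x ∈ Ico b c, u0 t x = 0 := by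
  intro t₀ ht₀ xs hxs
  by_contra hne
  set η := |u0 t₀ xs| with hη
  have hη0 : 0 < η := abs_pos.2 hne
  obtain ⟨δ, hδ, hδ1, hδ2⟩ : ∃ δ, 0 < δ ∧ δ < t₀ - τ₁ ∧ δ < τ₂ - t₀ := by
    obtain ⟨δ, h1, h2⟩ := exists_between (show 0 < min (t₀ - τ₁) (τ₂ - t₀) from
      lt_min (by linarith [ht₀.1]) (by linarith [ht₀.2]))
    exact ⟨δ, h1, lt_of_lt_of_le h2 (min_le_left _ _), lt_of_lt_of_le h2 (min_le_right _ _)⟩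
  have hJ : Icc (t₀ - δ) (t₀ + δ) ⊆ Ioo τ₁ τ₂ := fun t ht => ⟨by linarith [ht.1], by linarith [ht.2]⟩
  set D := c + 1 - b with hD
  set μ := D ^ 2 / δ ^ 2 with hμ
  have hμδ : μ * δ ^ 2 = D ^ 2 := by rw [hμ]; field_simp
  have hμ0 : 0 ≤ μ := by positivity
  obtain ⟨r, hr, hrδ, hxr, hNr, hrσ⟩ : ∃ r, 0 < r ∧ r < δ ∧ xs + r < c ∧ 2 * N * r < η / 2 ∧ 
      1 < (c + 1 - xs - r) ^ 2 - μ * r ^ 2 := by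
    have e1 : ∀ᶠ r in 𝓝[>] (0:ℝ), r < δ := mem_nhdsWithin_of_mem_nhds (Iio_mem_nhds hδ)
    have e2 : ∀ᶠ r in 𝓝[>] (0:ℝ), xs + r < c := by
      have : ContinuousAt (fun r : ℝ => xs + r) 0 := by fun_prop
      exact (this.eventually_lt (continuousAt_const) (by simpa using hxs.2)).filter_mono nhdsWithin_le_nhds
    have e3 : ∀ᶠ r in 𝓝[>] (0:ℝ), 2 * N * r < η / 2 := by
      have : ContinuousAt (fun r : ℝ => 2 * N * r) 0 := by fun_prop
      exact (this.eventually_lt (continuousAt_const) (by simpa using hη0)).filter_mono nhdsWithin_le_nhds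
    have e4 : ∀ᶠ r in 𝓝[>] (0:ℝ), 1 < (c + 1 - xs - r) ^ 2 - μ * r ^ 2 := by
      have : ContinuousAt (fun r : ℝ => (c + 1 - xs - r) ^ 2 - μ * r ^ 2) 0 := by fun_prop
      exact (continuousAt_const.eventually_lt this (by 
        have := hxs.2
        norm_num
        have : 1 < c + 1 - xs := by linarith
        rw [lt_abs]; left; linarith)).filter_mono nhdsWithin_le_nhds
    obtain ⟨r, h1, h2, h3, h4, h5⟩ := ((eventually_mem_nhdsWithin (a := (0:ℝ)) (s := Ioi 0)).and (e1.and (e2.and (e3.and e4)))).exists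
    exact ⟨r, h1, h2, h3, h4, h5⟩
  set κ := (η / 2) ^ 2 with hκ
  have hκ0 : 0 < κ := by positivity
  have hbox : ∀ t ∈ Icc (t₀ - r) (t₀ + r), ∀ x ∈ Icc xs (xs + r), κ ≤ u0 t x ^ 2 := by
    intro t ht x hx
    have htJ : t ∈ Ioo τ₁ τ₂ := hJ ⟨by linarith [ht.1], by linarith [ht.2]⟩
    have hxm : x ∈ Icc b c := ⟨by linarith [hx.1, hxs.1], by linarith [hx.2]⟩
    have hxsm : xs ∈ Icc b c := ⟨hxs.1, hxs.2.le⟩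
    have l1 : |u0 t x - u0 t₀ x| ≤ N * |t - t₀| :=
      (convex_Ioo τ₁ τ₂).norm_image_sub_le_of_norm_hasDerivWithin_le (f := fun t => u0 t x)
        (fun t ht => (h.dt t ht x hxm).hasDerivWithinAt) (fun t ht => h.bt t ht x hxm) ht₀ htJ
    have l2 : |u0 t₀ x - u0 t₀ xs| ≤ N * |x - xs| :=
      (convex_Icc b c).norm_image_sub_le_of_norm_hasDerivWithin_le (f := u0 t₀)
        (fun x hx => (h.d0 t₀ ht₀ x hx).hasDerivWithinAt) (fun x hx => h.b1 t₀ ht₀ x hx) hxsm hxm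
    have l3 : N * |t - t₀| ≤ N * r := by
      gcongr; exact abs_le.2 ⟨by linarith [ht.1], by linarith [ht.2]⟩
    have l4 : N * |x - xs| ≤ N * r := by
      gcongr; exact abs_le.2 ⟨by linarith [hx.1], by linarith [hx.2]⟩
    have l5 : η ≤ |u0 t x| + |u0 t x - u0 t₀ x| + |u0 t₀ x - u0 t₀ xs| := by
      have : u0 t₀ xs = u0 t x - (u0 t x - u0 t₀ x) - (u0 t₀ x - u0 t₀ xs) := by ring
      rw [hη]
      nth_rw 1 [this]
      exact (abs_sub _ _).trans (add_le_add_left (abs_sub _ _) _)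
    have l6 : η / 2 ≤ |u0 t x| := by linarith
    rw [hκ, ← sq_abs (u0 t x)]
    gcongr
  set σ := (c + 1 - xs - r) ^ 2 - μ * r ^ 2 - 1 with hσ
  have hσ0 : 0 < σ := by linarith
  set Q := 400 * δ * N ^ 2 + 14 * D ^ 4 * N ^ 2 with hQ
  have hQ0 : 0 ≤ Q := by positivity
  have hlo := (isLittleO_pow_exp_pos_mul_atTop 5 hσ0).def (show 0 < r ^ 2 * κ / (Q + 1) by positivity)
  obtain ⟨s, hs1, hs2, hs3, hs4⟩ := (hlo.and ((eventually_ge_atTop 1).and ((eventually_ge_atTop (C ^ 2)).and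
    (eventually_ge_atTop (6 * (μ * δ / 2)))))).exists
  have hk := key hbc hN h d2 c3 ctt hP hs2 hs3 hs4 hμ0 hδ rfl hμδ hJ hr hrδ hκ0.le hxs.1 hxr.le hbox
  rw [Real.norm_of_nonneg (by positivity), Real.norm_of_nonneg (Real.exp_pos _).le] at hs1
  have e1 : Real.exp (s * ((c + 1 - xs - r) ^ 2 - μ * r ^ 2)) = Real.exp (σ * s) * Real.exp s := by
    rw [← Real.exp_add]; congr 1; rw [hσ]; ring
  rw [e1] at hk
  have p1 : s ^ 3 ≤ s ^ 5 * Real.exp s := by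
    have q1 : s ^ 3 ≤ s ^ 5 := pow_le_pow_right₀ hs2 (by norm_num)
    have q2 : 1 ≤ Real.exp s := Real.one_le_exp (by linarith)
    exact q1.trans (le_mul_of_one_le_right (by positivity) q2)
  have p2 : 14 * D ^ 4 * N ^ 2 * s ^ 3 ≤ 14 * D ^ 4 * N ^ 2 * (s ^ 5 * Real.exp s) := by gcongr
  have p3 : (2 * r ^ 2 * κ * Real.exp (σ * s)) * Real.exp s ≤ (Q * s ^ 5) * Real.exp s := by
    rw [hQ]; linarith
  have p4 := le_of_mul_le_mul_right p3 (Real.exp_pos s)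
  have p5 : Q * s ^ 5 ≤ (Q + 1) * (r ^ 2 * κ / (Q + 1) * Real.exp (σ * s)) := by
    refine mul_le_mul (by linarith) hs1 (by positivity) (by positivity)
  have p6 : (Q + 1) * (r ^ 2 * κ / (Q + 1) * Real.exp (σ * s)) = r ^ 2 * κ * Real.exp (σ * s) := by
    field_simp
  have p7 : 0 < r ^ 2 * κ * Real.exp (σ * s) := by positivity
  linarith

/-- reflected version: vanishing at the right end -/
theorem core_left {b c τ₁ τ₂ N C : ℝ} {u0 u1 u2 u3 ut : ℝ → ℝ → ℝ} (hbc : b ≤ c) (hN : 0 ≤ N)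
    (d0 : ∀ t ∈ Ioo τ₁ τ₂, ∀ x ∈ Icc b c, HasDerivAt (u0 t) (u1 t x) x)
    (d1 : ∀ t ∈ Ioo τ₁ τ₂, ∀ x ∈ Icc b c, HasDerivAt (u1 t) (u2 t x) x)
    (d2 : ∀ t ∈ Ioo τ₁ τ₂, ∀ x ∈ Icc b c, HasDerivAt (u2 t) (u3 t x) x)
    (dt : ∀ t ∈ Ioo τ₁ τ₂, ∀ x ∈ Icc b c, HasDerivAt (fun t => u0 t x) (ut t x) t)
    (ct1 : ∀ x ∈ Icc b c, ContinuousOn (fun t => u1 t x) (Ioo τ₁ τ₂))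
    (ct2 : ∀ x ∈ Icc b c, ContinuousOn (fun t => u2 t x) (Ioo τ₁ τ₂))
    (b0 : ∀ t ∈ Ioo τ₁ τ₂, ∀ x ∈ Icc b c, |u0 t x| ≤ N)
    (b1 : ∀ t ∈ Ioo τ₁ τ₂, ∀ x ∈ Icc b c, |u1 t x| ≤ N)
    (b2 : ∀ t ∈ Ioo τ₁ τ₂, ∀ x ∈ Icc b c, |u2 t x| ≤ N)
    (bt : ∀ t ∈ Ioo τ₁ τ₂, ∀ x ∈ Icc b c, |ut t x| ≤ N)
    (z0 : ∀ t ∈ Ioo τ₁ τ₂, u0 t c = 0)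
    (z1 : ∀ t ∈ Ioo τ₁ τ₂, u1 t c = 0)
    (z2 : ∀ t ∈ Ioo τ₁ τ₂, u2 t c = 0)
    (c3 : ∀ t ∈ Ioo τ₁ τ₂, ContinuousOn (u3 t) (Icc b c))
    (ctt : ∀ t ∈ Ioo τ₁ τ₂, ContinuousOn (ut t) (Icc b c))
    (hP : ∀ t ∈ Ioo τ₁ τ₂, ∀ x ∈ Icc b c, |ut t x + u3 t x| ≤ C * |u1 t x|) :
    ∀ t ∈ Ioo τ₁ τ₂, ∀ x ∈ Ioc b c, u0 t x = 0 := by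
  have mt : ∀ t ∈ Ioo (-τ₂) (-τ₁), -t ∈ Ioo τ₁ τ₂ := fun t ht => ⟨by linarith [ht.2], by linarith [ht.1]⟩
  have mx : ∀ x ∈ Icc (-c) (-b), -x ∈ Icc b c := fun t ht => ⟨by linarith [ht.2], by linarith [ht.1]⟩
  have rx : ∀ (f : ℝ → ℝ) (f' x : ℝ), HasDerivAt f f' (-x) → HasDerivAt (fun x => f (-x)) (-f') x := by
    intro f f' x hf
    exact (hf.comp x (hasDerivAt_neg x)).congr_deriv (by ring)
  have hT : Tame (-c) (-b) (-τ₂) (-τ₁) N (fun t x => u0 (-t) (-x)) (fun t x => -u1 (-t) (-x))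
      (fun t x => u2 (-t) (-x)) (fun t x => -ut (-t) (-x)) := by
    constructor
    · exact fun t ht x hx => rx _ _ _ (d0 _ (mt t ht) _ (mx x hx))
    · intro t ht x hx
      exact ((rx _ _ _ (d1 _ (mt t ht) _ (mx x hx))).neg).congr_deriv (by ring)
    · intro t ht x hx
      exact (rx _ _ _ (d2 _ (mt t ht) _ (mx x hx))).continuousAt.continuousWithinAt
    · exact fun t ht x hx => rx (fun t => u0 t (-x)) _ _ (dt _ (mt t ht) _ (mx x hx))
    · exact fun x hx => ((ct1 _ (mx x hx)).comp continuous_neg.continuousOn mt).neg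
    · exact fun x hx => ((ct2 _ (mx x hx)).comp continuous_neg.continuousOn mt)
    · exact fun t ht x hx => b0 _ (mt t ht) _ (mx x hx)
    · intro t ht x hx; rw [abs_neg]; exact b1 _ (mt t ht) _ (mx x hx)
    · exact fun t ht x hx => b2 _ (mt t ht) _ (mx x hx)
    · intro t ht x hx; rw [abs_neg]; exact bt _ (mt t ht) _ (mx x hx)
    · intro t ht; simpa using z0 _ (mt t ht)
    · intro t ht; simpa using z1 _ (mt t ht)
    · intro t ht; simpa using z2 _ (mt t ht)
  have := core (u3 := fun t x => -u3 (-t) (-x)) (C := C) (by linarith) hN hT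
    (fun t ht x hx => rx _ _ _ (d2 _ (mt t ht) _ (mx x hx)))
    (fun t ht => ((c3 _ (mt t ht)).comp continuous_neg.continuousOn mx).neg)
    (fun t ht => ((ctt _ (mt t ht)).comp continuous_neg.continuousOn mx).neg)
    (fun t ht x hx => by
      have := hP _ (mt t ht) _ (mx x hx)
      rwa [abs_neg, ← neg_add, abs_neg])
  intro t ht x hx
  simpa using this (-t) ⟨by linarith [ht.2], by linarith [ht.1]⟩ (-x) ⟨by linarith [hx.2], by linarith [hx.1]⟩

theorem derivlim {ι : Type*} {l : Filter ι} {g g1 g2 : ι → ℝ → ℝ} {α β N : ℝ}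
    (h : ∀ᶠ i in l, ∀ x ∈ Ioo α β, HasDerivAt (g i) (g1 i x) x ∧ HasDerivAt (g1 i) (g2 i x) x ∧ |g2 i x| ≤ N)
    (hg : ∀ x ∈ Ioo α β, Tendsto (fun i => g i x) l (𝓝 0)) :
    ∀ x ∈ Ioo α β, Tendsto (fun i => g1 i x) l (𝓝 0) := by
  intro x hx
  rw [Metric.tendsto_nhds]
  intro ε hε
  obtain ⟨r, hr, hxr, hNr⟩ : ∃ r, 0 < r ∧ x + r < β ∧ N * r < ε / 2 := by
    have e2 : ∀ᶠ r in 𝓝[>] (0:ℝ), x + r < β := by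
      have : ContinuousAt (fun r : ℝ => x + r) 0 := by fun_prop
      exact (this.eventually_lt (continuousAt_const) (by simpa using hx.2)).filter_mono nhdsWithin_le_nhds
    have e3 : ∀ᶠ r in 𝓝[>] (0:ℝ), N * r < ε / 2 := by
      have : ContinuousAt (fun r : ℝ => N * r) 0 := by fun_prop
      exact (this.eventually_lt (continuousAt_const) (by simpa using hε)).filter_mono nhdsWithin_le_nhds
    obtain ⟨r, h1, h2, h3⟩ := ((eventually_mem_nhdsWithin (a := (0:ℝ)) (s := Ioi 0)).and (e2.and e3)).exists
    exact ⟨r, h1, h2, h3⟩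
  have hxr' : x + r ∈ Ioo α β := ⟨by linarith [hx.1], hxr⟩
  have k1 := (Metric.tendsto_nhds.1 (hg x hx)) (ε * r / 4) (by positivity)
  have k2 := (Metric.tendsto_nhds.1 (hg _ hxr')) (ε * r / 4) (by positivity)
  filter_upwards [h, k1, k2] with i hi k1 k2
  rw [Real.dist_eq, sub_zero] at *
  have hsub : Icc x (x + r) ⊆ Ioo α β := fun z hz => ⟨by linarith [hz.1, hx.1], by linarith [hz.2]⟩
  obtain ⟨ξ, hξ, hξe⟩ := exists_hasDerivAt_eq_slope (g i) (g1 i) (show x < x + r by linarith)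
    (fun z hz => (hi z (hsub hz)).1.continuousAt.continuousWithinAt)
    (fun z hz => (hi z (hsub (Ioo_subset_Icc_self hz))).1)
  have hξI := hsub (Ioo_subset_Icc_self hξ)
  have l1 : |g1 i x - g1 i ξ| ≤ N * |x - ξ| :=
    (convex_Ioo α β).norm_image_sub_le_of_norm_hasDerivWithin_le (f := g1 i)
      (fun x hx => (hi x hx).2.1.hasDerivWithinAt) (fun x hx => (hi x hx).2.2) hξI hx
  have hN : 0 ≤ N := (abs_nonneg _).trans (hi x hx).2.2
  have l2 : N * |x - ξ| ≤ N * r := by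
    gcongr; exact abs_le.2 ⟨by linarith [hξ.2], by linarith [hξ.1]⟩
  have l3 : |g1 i ξ| < ε / 2 := by
    rw [hξe, add_sub_cancel_left, abs_div, abs_of_pos hr, div_lt_iff₀ hr]
    have := abs_sub (g i (x + r)) (g i x)
    linarith
  have l4 : |g1 i x| ≤ |g1 i x - g1 i ξ| + |g1 i ξ| := by
    have := abs_add_le (g1 i x - g1 i ξ) (g1 i ξ)
    simpa using this
  linarith

def EN (L : ℝ) (u0 u1 u2 u3 : ℝ → ℝ → ℝ) (n : ℝ) : Set ℝ :=
  {t | ∀ x ∈ Ioo 0 L, |u0 t x| ≤ n ∧ |u1 t x| ≤ n ∧ |u2 t x| ≤ n ∧ |u3 t x| ≤ n}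

theorem EN_exists {L : ℝ} {u0 u1 u2 u3 : ℝ → ℝ → ℝ} (hL : 0 < L)
    (d0 : ∀ t x, HasDerivAt (u0 t) (u1 t x) x) (d1 : ∀ t x, HasDerivAt (u1 t) (u2 t x) x)
    (d2 : ∀ t x, HasDerivAt (u2 t) (u3 t x) x) (c3 : ∀ t, Continuous (u3 t)) (t : ℝ) :
    ∃ n : ℕ, t ∈ EN L u0 u1 u2 u3 n := by
  have bd : ∀ f : ℝ → ℝ, Continuous f → ∃ M, ∀ x ∈ Icc 0 L, |f x| ≤ M := fun f hf =>
    isCompact_Icc.exists_bound_of_continuousOn hf.continuousOn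
  obtain ⟨M0, h0⟩ := bd (u0 t) (continuous_iff_continuousAt.2 fun x => (d0 t x).continuousAt)
  obtain ⟨M1, h1⟩ := bd (u1 t) (continuous_iff_continuousAt.2 fun x => (d1 t x).continuousAt)
  obtain ⟨M2, h2⟩ := bd (u2 t) (continuous_iff_continuousAt.2 fun x => (d2 t x).continuousAt)
  obtain ⟨M3, h3⟩ := bd (u3 t) (c3 t)
  obtain ⟨n, hn⟩ := exists_nat_ge (max (max M0 M1) (max M2 M3))
  simp only [max_le_iff] at hn
  refine ⟨n, fun x hx => ?_⟩
  have hx := Ioo_subset_Icc_self hx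
  exact ⟨(h0 x hx).trans hn.1.1, (h1 x hx).trans hn.1.2, (h2 x hx).trans hn.2.1, (h3 x hx).trans hn.2.2⟩

theorem EN_conv {L : ℝ} {u0 u1 u2 u3 : ℝ → ℝ → ℝ} (hL : 0 < L)
    (d0 : ∀ t x, HasDerivAt (u0 t) (u1 t x) x) (d1 : ∀ t x, HasDerivAt (u1 t) (u2 t x) x)
    (d2 : ∀ t x, HasDerivAt (u2 t) (u3 t x) x) (c3 : ∀ t, Continuous (u3 t))
    (hct : ∀ x, Continuous (fun t => u0 t x))
    {ι : Type*} {l : Filter ι} {f : ι → ℝ} {t : ℝ} {n : ℕ} (hf : Tendsto f l (𝓝 t))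
    (hE : ∀ᶠ i in l, f i ∈ EN L u0 u1 u2 u3 n) : ∀ x ∈ Ioo 0 L, 
      Tendsto (fun i => u0 (f i) x) l (𝓝 (u0 t x)) ∧ Tendsto (fun i => u1 (f i) x) l (𝓝 (u1 t x)) ∧
      Tendsto (fun i => u2 (f i) x) l (𝓝 (u2 t x)) := by
  obtain ⟨m, hm⟩ := EN_exists hL d0 d1 d2 c3 t
  have k0 : ∀ x ∈ Ioo 0 L, Tendsto (fun i => u0 (f i) x) l (𝓝 (u0 t x)) := fun x _ =>
    ((hct x).tendsto t).comp hf
  have k1 := derivlim (l := l) (g := fun i x => u0 (f i) x - u0 t x) (g1 := fun i x => u1 (f i) x - u1 t x)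
    (g2 := fun i x => u2 (f i) x - u2 t x) (α := 0) (β := L) (N := n + m) (by
      filter_upwards [hE] with i hi x hx
      exact ⟨(d0 _ x).sub (d0 _ x), (d1 _ x).sub (d1 _ x), (abs_sub _ _).trans (add_le_add (hi x hx).2.2.1 (hm x hx).2.2.1)⟩)
    (fun x hx => by simpa using (k0 x hx).sub_const (u0 t x))
  have k2 := derivlim (l := l) (g := fun i x => u1 (f i) x - u1 t x) (g1 := fun i x => u2 (f i) x - u2 t x)
    (g2 := fun i x => u3 (f i) x - u3 t x) (α := 0) (β := L) (N := n + m) (by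
      filter_upwards [hE] with i hi x hx
      exact ⟨(d1 _ x).sub (d1 _ x), (d2 _ x).sub (d2 _ x), (abs_sub _ _).trans (add_le_add (hi x hx).2.2.2 (hm x hx).2.2.2)⟩)
    k1
  exact fun x hx => ⟨k0 x hx, by simpa using (k1 x hx).add_const (u1 t x), by simpa using (k2 x hx).add_const (u2 t x)⟩

theorem EN_closed {L : ℝ} {u0 u1 u2 u3 : ℝ → ℝ → ℝ} (hL : 0 < L)
    (d0 : ∀ t x, HasDerivAt (u0 t) (u1 t x) x) (d1 : ∀ t x, HasDerivAt (u1 t) (u2 t x) x)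
    (d2 : ∀ t x, HasDerivAt (u2 t) (u3 t x) x) (c3 : ∀ t, Continuous (u3 t))
    (hct : ∀ x, Continuous (fun t => u0 t x)) (n : ℕ) : IsClosed (EN L u0 u1 u2 u3 n) := by
  apply IsSeqClosed.isClosed
  intro f t hfE hf
  have hc := EN_conv hL d0 d1 d2 c3 hct hf (Eventually.of_forall hfE)
  intro x hx
  obtain ⟨k0, k1, k2⟩ := hc x hx
  refine ⟨le_of_tendsto k0.abs (Eventually.of_forall fun i => (hfE i x hx).1),
    le_of_tendsto k1.abs (Eventually.of_forall fun i => (hfE i x hx).2.1),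
    le_of_tendsto k2.abs (Eventually.of_forall fun i => (hfE i x hx).2.2.1), ?_⟩
  refine (d2 t x).le_of_lip' (Nat.cast_nonneg n) ?_
  filter_upwards [Ioo_mem_nhds hx.1 hx.2] with z hz
  refine le_of_tendsto ((hc z hz).2.2.sub k2).norm (Eventually.of_forall fun i => ?_)
  exact (convex_Ioo 0 L).norm_image_sub_le_of_norm_hasDerivWithin_le (f := u2 (f i))
      (fun x hx => (d2 _ x).hasDerivWithinAt) (fun x hx => (hfE i x hx).2.2.2) hx hz

theorem zero_deriv {f f' : ℝ → ℝ} {U : Set ℝ} (hU : IsOpen U) (hf : ∀ x, HasDerivAt f (f' x) x)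
    (h : ∀ x ∈ U, f x = 0) : ∀ x ∈ U, f' x = 0 := by
  intro x hx
  have e : (fun _ => (0:ℝ)) =ᶠ[𝓝 x] f := by
    filter_upwards [hU.mem_nhds hx] with z hz
    exact (h z hz).symm
  exact ((hf x).congr_of_eventuallyEq e).unique (hasDerivAt_const x 0)

/-- the bounded case -/
theorem bounded_case {L τ₁ τ₂ p : ℝ} {u0 u1 u2 u3 ut : ℝ → ℝ → ℝ} (hL : 0 < L)
    (d0 : ∀ t x, HasDerivAt (u0 t) (u1 t x) x) (d1 : ∀ t x, HasDerivAt (u1 t) (u2 t x) x)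
    (d2 : ∀ t x, HasDerivAt (u2 t) (u3 t x) x) (c3 : ∀ t, Continuous (u3 t))
    (dt : ∀ t x, HasDerivAt (fun t => u0 t x) (ut t x) t)
    (hpde : ∀ t ∈ Ioo τ₁ τ₂, ∀ x ∈ Ioo 0 L, ut t x + u1 t x + u3 t x + u0 t x * u1 t x = 0)
    (hp : p ∈ Ioo 0 L) (z0 : ∀ t ∈ Ioo τ₁ τ₂, u0 t p = 0) (z1 : ∀ t ∈ Ioo τ₁ τ₂, u1 t p = 0)
    (z2 : ∀ t ∈ Ioo τ₁ τ₂, u2 t p = 0) {n : ℕ} (hE : ∀ t ∈ Ioo τ₁ τ₂, t ∈ EN L u0 u1 u2 u3 n) :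
    ∀ t ∈ Ioo τ₁ τ₂, ∀ x ∈ Ioo 0 L, u0 t x = 0 := by
  have hct : ∀ x, Continuous (fun t => u0 t x) := fun x => continuous_iff_continuousAt.2 fun t => (dt t x).continuousAt
  have hcont : ∀ t ∈ Ioo τ₁ τ₂, ∀ x ∈ Ioo 0 L, ContinuousAt (fun t => u1 t x) t ∧ ContinuousAt (fun t => u2 t x) t := by
    intro t ht x hx
    have := EN_conv hL d0 d1 d2 c3 hct (l := 𝓝 t) (f := fun t => t) (n := n) tendsto_id
      (by filter_upwards [Ioo_mem_nhds ht.1 ht.2] with t' ht' using hE t' ht') x hx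
    exact ⟨this.2.1, this.2.2⟩
  have hn0 : (0:ℝ) ≤ n := Nat.cast_nonneg n
  set N : ℝ := n + n + n * n with hN
  have hnn : 0 ≤ (n:ℝ) * n := by positivity
  have hnN : (n:ℝ) ≤ N := by linarith
  have hut : ∀ t ∈ Ioo τ₁ τ₂, ∀ x ∈ Ioo 0 L, ut t x = -(u1 t x + u3 t x + u0 t x * u1 t x) := by
    intro t ht x hx; linarith [hpde t ht x hx]
  have bt : ∀ t ∈ Ioo τ₁ τ₂, ∀ x ∈ Ioo 0 L, |ut t x| ≤ N := by
    intro t ht x hx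
    obtain ⟨b0, b1, b2, b3⟩ := hE t ht x hx
    rw [hut t ht x hx, abs_neg]
    exact (abs_add_le _ _).trans (add_le_add ((abs_add_le _ _).trans (add_le_add b1 b3)) (mulb b0 b1))
  have hP : ∀ t ∈ Ioo τ₁ τ₂, ∀ x ∈ Ioo 0 L, |ut t x + u3 t x| ≤ (1 + n) * |u1 t x| := by
    intro t ht x hx
    obtain ⟨b0, b1, b2, b3⟩ := hE t ht x hx
    have : ut t x + u3 t x = -((1 + u0 t x) * u1 t x) := by rw [hut t ht x hx]; ring
    rw [this, abs_neg, abs_mul]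
    have : |1 + u0 t x| ≤ 1 + n := (abs_add_le _ _).trans (by rw [abs_one]; linarith)
    gcongr
  have hcut : ∀ t ∈ Ioo τ₁ τ₂, ContinuousOn (ut t) (Ioo 0 L) := by
    intro t ht
    have a0 : Continuous (u0 t) := continuous_iff_continuousAt.2 fun x => (d0 t x).continuousAt
    have a1 : Continuous (u1 t) := continuous_iff_continuousAt.2 fun x => (d1 t x).continuousAt
    have a3 := c3 t
    refine ContinuousOn.congr (f := fun x => -(u1 t x + u3 t x + u0 t x * u1 t x)) ?_ (hut t ht)
    fun_prop
  have c2 : ∀ t, Continuous (u2 t) := fun t => continuous_iff_continuousAt.2 fun x => (d2 t x).continuousAt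
  intro t ht x hx
  rcases le_or_gt p x with hpx | hpx
  · have hsub : Icc p ((x + L) / 2) ⊆ Ioo 0 L := fun z hz => ⟨by linarith [hp.1, hz.1], by linarith [hz.2, hx.2]⟩
    refine core (b := p) (c := (x + L) / 2) (N := N) (C := 1 + n) (u0 := u0) (u1 := u1) (u2 := u2) (u3 := u3) (ut := ut) (by linarith [hx.2]) (by linarith) ?_
      (fun t _ x _ => d2 t x) (fun t _ => (c3 t).continuousOn) (fun t ht => (hcut t ht).mono hsub)
      (fun t ht x hx => hP t ht x (hsub hx)) t ht x ⟨hpx, by linarith [hx.2]⟩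
    exact {
      d0 := fun t _ x _ => d0 t x
      d1 := fun t _ x _ => d1 t x
      c2 := fun t _ => (c2 t).continuousOn
      dt := fun t _ x _ => dt t x
      ct1 := fun x hx t ht => (hcont t ht x (hsub hx)).1.continuousWithinAt
      ct2 := fun x hx t ht => (hcont t ht x (hsub hx)).2.continuousWithinAt
      b0 := fun t ht x hx => (hE t ht x (hsub hx)).1.trans hnN
      b1 := fun t ht x hx => (hE t ht x (hsub hx)).2.1.trans hnN
      b2 := fun t ht x hx => (hE t ht x (hsub hx)).2.2.1.trans hnN
      bt := fun t ht x hx => bt t ht x (hsub hx)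
      z0 := z0
      z1 := z1
      z2 := z2 }
  · have hsub : Icc (x / 2) p ⊆ Ioo 0 L := fun z hz => ⟨by linarith [hx.1, hz.1], by linarith [hz.2, hp.2]⟩
    exact core_left (b := x / 2) (c := p) (N := N) (C := 1 + n) (u0 := u0) (u1 := u1) (u2 := u2) (u3 := u3) (ut := ut) (by linarith [hx.1]) (by linarith)
      (fun t _ x _ => d0 t x) (fun t _ x _ => d1 t x) (fun t _ x _ => d2 t x) (fun t _ x _ => dt t x)
      (fun x hx t ht => (hcont t ht x (hsub hx)).1.continuousWithinAt)
      (fun x hx t ht => (hcont t ht x (hsub hx)).2.continuousWithinAt)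
      (fun t ht x hx => (hE t ht x (hsub hx)).1.trans hnN)
      (fun t ht x hx => (hE t ht x (hsub hx)).2.1.trans hnN)
      (fun t ht x hx => (hE t ht x (hsub hx)).2.2.1.trans hnN)
      (fun t ht x hx => bt t ht x (hsub hx)) z0 z1 z2
      (fun t _ => (c3 t).continuousOn) (fun t ht => (hcut t ht).mono hsub)
      (fun t ht x hx => hP t ht x (hsub hx)) t ht x ⟨by linarith [hx.1], hpx.le⟩

theorem stmt17 (L T t₁ t₂ : ℝ) (hL : 0 < L) (ht : 0 < t₁ ∧ t₁ < t₂ ∧ t₂ < T)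
    (y : ℝ → ℝ → ℝ)
    (hyx : ∀ t, ContDiff ℝ 3 (y t))
    (hyt : ∀ x, Differentiable ℝ (fun t => y t x))
    (hpde : ∀ t ∈ Set.Ioo (0:ℝ) T, ∀ x ∈ Set.Ioo (0:ℝ) L,
      deriv (fun τ => y τ x) t + deriv (y t) x + iteratedDeriv 3 (y t) x
        + y t x * deriv (y t) x = 0)
    (ω : Set ℝ) (hω : IsOpen ω) (hωne : ω.Nonempty) (hωsub : ω ⊆ Set.Ioo 0 L)
    (hvanish : ∀ t ∈ Set.Ioo t₁ t₂, ∀ x ∈ ω, y t x = 0) :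
    ∀ t ∈ Set.Ioo t₁ t₂, ∀ x ∈ Set.Ioo (0:ℝ) L, y t x = 0 := by
  obtain ⟨p, hp⟩ := hωne
  have hdi : ∀ k : ℕ, k < 3 → ∀ t x, HasDerivAt (iteratedDeriv k (y t)) (iteratedDeriv (k + 1) (y t) x) x := by
    intro k hk t x
    rw [iteratedDeriv_succ]
    exact ((hyx t).differentiable_iteratedDeriv k (by exact_mod_cast hk) x).hasDerivAt
  set u1 : ℝ → ℝ → ℝ := fun t => iteratedDeriv 1 (y t) with hu1
  set u2 : ℝ → ℝ → ℝ := fun t => iteratedDeriv 2 (y t) with hu2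
  set u3 : ℝ → ℝ → ℝ := fun t => iteratedDeriv 3 (y t) with hu3
  set ut : ℝ → ℝ → ℝ := fun t x => deriv (fun τ => y τ x) t with hut
  have d0 : ∀ t x, HasDerivAt (y t) (u1 t x) x := fun t x => by
    have := hdi 0 (by norm_num) t x
    rwa [iteratedDeriv_zero] at this
  have d1 : ∀ t x, HasDerivAt (u1 t) (u2 t x) x := hdi 1 (by norm_num)
  have d2 : ∀ t x, HasDerivAt (u2 t) (u3 t x) x := hdi 2 (by norm_num)
  have c3 : ∀ t, Continuous (u3 t) := fun t => (hyx t).continuous_iteratedDeriv 3 (by norm_num)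
  have dt : ∀ t x, HasDerivAt (fun t => y t x) (ut t x) t := fun t x => (hyt x t).hasDerivAt
  have hpde' : ∀ t ∈ Ioo t₁ t₂, ∀ x ∈ Ioo 0 L, ut t x + u1 t x + u3 t x + y t x * u1 t x = 0 := by
    intro t htt x hx
    have := hpde t ⟨by linarith [htt.1], by linarith [htt.2]⟩ x hx
    rw [(d0 t x).deriv] at this
    exact this
  have z0 : ∀ t ∈ Ioo t₁ t₂, ∀ x ∈ ω, y t x = 0 := hvanish
  have z1 : ∀ t ∈ Ioo t₁ t₂, ∀ x ∈ ω, u1 t x = 0 := fun t ht => zero_deriv hω (d0 t) (z0 t ht)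
  have z2 : ∀ t ∈ Ioo t₁ t₂, ∀ x ∈ ω, u2 t x = 0 := fun t ht => zero_deriv hω (d1 t) (z1 t ht)
  set V : Set ℝ := {t | ∀ᶠ t' in 𝓝 t, t' ∈ Ioo t₁ t₂ → ∀ x ∈ Ioo 0 L, y t' x = 0} with hV
  have hVo : IsOpen V := isOpen_setOf_eventually_nhds
  suffices hVu : ∀ t, t ∈ V by
    intro t ht
    exact (hVu t).self_of_nhds ht
  by_contra hcon
  push Not at hcon
  obtain ⟨s₀, hs₀⟩ := hcon
  have hFc : IsClosed Vᶜ := hVo.isClosed_compl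
  haveI : CompleteSpace ↥(Vᶜ) := hFc.completeSpace_coe
  haveI : Nonempty ↥(Vᶜ) := ⟨⟨s₀, hs₀⟩⟩
  have hct : ∀ x, Continuous (fun t => y t x) := fun x => (hyt x).continuous
  obtain ⟨n, ⟨ts, hts⟩, htsI⟩ := nonempty_interior_of_iUnion_of_closed
    (X := ↥(Vᶜ)) (f := fun n : ℕ => Subtype.val ⁻¹' EN L y u1 u2 u3 n)
    (fun n => (EN_closed hL d0 d1 d2 c3 hct n).preimage continuous_subtype_val) (by
      rw [eq_univ_iff_forall]
      rintro ⟨t, ht⟩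
      obtain ⟨n, hn⟩ := EN_exists hL d0 d1 d2 c3 t
      exact mem_iUnion.2 ⟨n, hn⟩)
  rw [mem_interior_iff_mem_nhds, Metric.mem_nhds_iff] at htsI
  obtain ⟨ε, hε, hball⟩ := htsI
  have hEN : ∀ t ∈ Ioo (max t₁ (ts - ε)) (min t₂ (ts + ε)), t ∈ EN L y u1 u2 u3 n := by
    intro t ht
    have h1 := max_lt_iff.1 ht.1
    have h2 := lt_min_iff.1 ht.2
    by_cases htV : t ∈ V
    · have y0 := htV.self_of_nhds ⟨h1.1, h2.1⟩
      have y1 := zero_deriv isOpen_Ioo (d0 t) y0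
      have y2 := zero_deriv isOpen_Ioo (d1 t) y1
      have y3 := zero_deriv isOpen_Ioo (d2 t) y2
      intro x hx
      rw [y0 x hx, y1 x hx, y2 x hx, y3 x hx]
      simp
    · refine hball (a := ⟨t, htV⟩) ?_
      rw [Metric.mem_ball, Subtype.dist_eq, Real.dist_eq]
      exact abs_lt.2 ⟨by linarith, by linarith⟩
  have hsub : ∀ t ∈ Ioo (max t₁ (ts - ε)) (min t₂ (ts + ε)), t ∈ Ioo t₁ t₂ := fun t ht =>
    ⟨(max_lt_iff.1 ht.1).1, (lt_min_iff.1 ht.2).1⟩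
  have hz := bounded_case hL d0 d1 d2 c3 dt (fun t ht => hpde' t (hsub t ht)) (hωsub hp)
    (fun t ht => z0 t (hsub t ht) p hp) (fun t ht => z1 t (hsub t ht) p hp)
    (fun t ht => z2 t (hsub t ht) p hp) hEN
  refine hts ?_
  have hnb : Ioo (ts - ε) (ts + ε) ∈ 𝓝 ts := Ioo_mem_nhds (by linarith) (by linarith)
  change ∀ᶠ t' in 𝓝 ts, _
  filter_upwards [hnb] with t' ht' htt
  exact hz t' ⟨max_lt htt.1 ht'.1, lt_min htt.2 ht'.2⟩
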